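/- arXiv:2110.13261 — 4 statements merged into one kernel-verified Lean document; each statement's English description precedes it below -/
import Mathlib

section
/- Let c : ℕ → ℕ satisfy c 2 = 0, c 3 = 2, c 4 = 3, and c m = c ⌈m/2⌉ + c ⌊m/2⌋ + 3 for all m ≥ 5. Then for every m ≥ 2, c m ≤ 2*m − 3. In particular the CSWAP-gate count of the pairing unitary 𝒰_m for an arbitrary number m of input states is O(m). -/
/-- CSWAP-gate count of the pairing unitary `𝒰_m` for arbitrary `m`: with base
cases `c 2 = 0`, `c 3 = 2`, `c 4 = 3` and recursion
`c m = c ⌈m/2⌉ + c ⌊m/2⌋ + 3` for `m ≥ 5`, one has `c m ≤ 2m − 3` for `m ≥ 2`,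
hence the gate count is `O(m)`. -/
theorem cswap_count_linear (c : ℕ → ℕ) (h2 : c 2 = 0) (h3 : c 3 = 2) (h4 : c 4 = 3)
    (hrec : ∀ m : ℕ, 5 ≤ m → c m = c ((m + 1) / 2) + c (m / 2) + 3) :
    ∀ m : ℕ, 2 ≤ m → c m ≤ 2 * m - 3 := by
  intro m
  induction m using Nat.strong_induction_on with
  | _ m ih =>
    intro hm
    rcases Nat.lt_or_ge m 5 with hlt | hge
    · interval_cases m <;> omega
    · have hceil := ih ((m + 1) / 2) (by omega) (by omega)
      have hfloor := ih (m / 2) (by omega) (by omega)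
      have hstep := hrec m hge
      omega
end

section
/- Let d : ℕ → ℕ satisfy d 2 = 0, d 3 = 2, d 4 = 3, and d m = d ⌈m/2⌉ + 3 for all m ≥ 5. Then for every m ≥ 2, (d m : ℝ) ≤ 3 * logb 2 (m − 1), where logb 2 is the real logarithm in base 2. In particular the ancillary-qubit count of the pairing unitary 𝒰_m for an arbitrary number m of input states is O(log m). -/
/-- Ancillary count of the pairing unitary `𝒰_m` for arbitrary `m`: with base
cases `d 2 = 0`, `d 3 = 2`, `d 4 = 3` and recursion `d m = d ⌈m/2⌉ + 3` for
`m ≥ 5`, one has `d m ≤ 3·log₂(m − 1)` for `m ≥ 2`, hence `O(log m)` ancillas. -/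
theorem ancilla_count_log (d : ℕ → ℕ) (h2 : d 2 = 0) (h3 : d 3 = 2) (h4 : d 4 = 3)
    (hrec : ∀ m : ℕ, 5 ≤ m → d m = d ((m + 1) / 2) + 3) :
    ∀ m : ℕ, 2 ≤ m → (d m : ℝ) ≤ 3 * Real.logb 2 ((m : ℝ) - 1) := by
  have hmono : ∀ x y : ℝ, 0 < x → x ≤ y → Real.logb 2 x ≤ Real.logb 2 y := fun x y hx hxy =>
    Real.logb_le_logb_of_le (by norm_num) hx hxy
  have hone : Real.logb 2 2 = 1 := Real.logb_self_eq_one (by norm_num)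
  intro m
  induction m using Nat.strong_induction_on with
  | _ m ih =>
    intro hm
    rcases lt_or_ge m 5 with hlt | hge
    · interval_cases m
      · norm_num [h2]
      · norm_num [h3]
      · have h := hmono 2 3 (by norm_num) (by norm_num)
        norm_num [h4]
        linarith
    · have hdm := ih ((m + 1) / 2) (by omega) (by omega)
      have hlow : (2 : ℝ) ≤ ((m + 1) / 2 : ℕ) := by
        exact_mod_cast (by omega : 2 ≤ (m + 1) / 2)
      have hhalf : (2 : ℝ) * ((m + 1) / 2 : ℕ) ≤ m + 1 := by
        exact_mod_cast (by omega : 2 * ((m + 1) / 2) ≤ m + 1)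
      have hlog := hmono (2 * ((((m + 1) / 2 : ℕ) : ℝ) - 1)) (m - 1) (by linarith) (by linarith)
      rw [Real.logb_mul (by norm_num) (by linarith), hone] at hlog
      rw [hrec m hge]
      push_cast at *
      linarith
end

section
/- Let a, b ≥ 2 and set m = a + b. Let I, J be index types and let σ : I → Equiv.Perm (Fin m) be a family of permutations each of which fixes every position p with p ≥ a, such that for all x ≠ y with x, y < a there is i ∈ I with {σ i 0, σ i 1} = {x, y}; let τ : J → Equiv.Perm (Fin m) be a family each of which fixes every position p < a, such that for all x ≠ y with a ≤ x and a ≤ y there is j ∈ J with {τ j a, τ j (a+1)} = {x, y}. Define u₁ = swap 0 a, u₂ = swap 0 (a+1), u₃ = swap 1 a in Equiv.Perm (Fin m), and for (i, j, b₁, b₂, b₃) ∈ I × J × Bool³ define ρ = (σ i * τ j) * (if b₁ then u₁ else 1) * (if b₂ then u₂ else 1) * (if b₃ then u₃ else 1). Then the family ρ : I × J × Bool³ → Equiv.Perm (Fin m) realizes all pairs: for every x ≠ y in Fin m there is an index (i,j,b) with {ρ 0, ρ 1} = {x, y}. -/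
/-- Three optional swaps `(p r)`, `(p s)`, `(q r)` bring any two of four distinct positions
`p, q, r, s` to the positions `p, q`. -/
lemma exists_swaps_pair_eq {α : Type*} [DecidableEq α] {p q r s : α}
    (hpq : p ≠ q) (hpr : p ≠ r) (hps : p ≠ s) (hqr : q ≠ r) (hqs : q ≠ s) (hrs : r ≠ s)
    (π : Equiv.Perm α) {u v : α} (huv : u ≠ v)
    (hu : u = p ∨ u = q ∨ u = r ∨ u = s) (hv : v = p ∨ v = q ∨ v = r ∨ v = s) :
    ∃ b₁ b₂ b₃ : Bool,
      ({(π * (if b₁ then Equiv.swap p r else 1) * (if b₂ then Equiv.swap p s else 1) *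
          (if b₃ then Equiv.swap q r else 1)) p,
        (π * (if b₁ then Equiv.swap p r else 1) * (if b₂ then Equiv.swap p s else 1) *
          (if b₃ then Equiv.swap q r else 1)) q} : Set α) = {π u, π v} := by
  have h₁ := hpq.symm
  have h₂ := hpr.symm
  have h₃ := hps.symm
  have h₄ := hqr.symm
  have h₅ := hqs.symm
  have h₆ := hrs.symm
  simp only [Set.pair_eq_pair_iff, Equiv.Perm.mul_apply, π.injective.eq_iff]
  rcases hu with rfl | rfl | rfl | rfl <;> rcases hv with rfl | rfl | rfl | rfl <;>
    first
    | exact absurd rfl huv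
    | simp [Equiv.swap_apply_def, *]

/-- Recursive step of the pairing-unitary construction: given a family `σ`
pairing the first `a` registers onto positions 0, 1 and a family `τ` pairing
the last `b` registers onto positions `a`, `a+1`, a final `𝒰₄` block of three
controlled swaps on positions 0, 1, `a`, `a+1` realizes all pairs of the
`m = a + b` registers. -/
theorem pairing_unitary_recursive_step
    (a b : ℕ) (ha : 2 ≤ a) (hb : 2 ≤ b) (m : ℕ) (hm : m = a + b)
    {I J : Type*}
    (σ : I → Equiv.Perm (Fin m)) (τ : J → Equiv.Perm (Fin m))
    (hσfix : ∀ (i : I) (p : Fin m), a ≤ (p : ℕ) → σ i p = p)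
    (hσ : ∀ x y : Fin m, x ≠ y → (x : ℕ) < a → (y : ℕ) < a → ∃ i : I,
      ({σ i ⟨0, by omega⟩, σ i ⟨1, by omega⟩} : Set (Fin m)) = {x, y})
    (hτfix : ∀ (j : J) (p : Fin m), (p : ℕ) < a → τ j p = p)
    (hτ : ∀ x y : Fin m, x ≠ y → a ≤ (x : ℕ) → a ≤ (y : ℕ) → ∃ j : J,
      ({τ j ⟨a, by omega⟩, τ j ⟨a + 1, by omega⟩} : Set (Fin m)) = {x, y})
    (ρ : I × J × Bool × Bool × Bool → Equiv.Perm (Fin m))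
    (hρ : ∀ (i : I) (j : J) (b₁ b₂ b₃ : Bool), ρ (i, j, b₁, b₂, b₃) =
      (σ i * τ j) *
      (if b₁ then Equiv.swap (⟨0, by omega⟩ : Fin m) ⟨a, by omega⟩ else 1) *
      (if b₂ then Equiv.swap (⟨0, by omega⟩ : Fin m) ⟨a + 1, by omega⟩ else 1) *
      (if b₃ then Equiv.swap (⟨1, by omega⟩ : Fin m) ⟨a, by omega⟩ else 1)) :
    ∀ x y : Fin m, x ≠ y → ∃ c : I × J × Bool × Bool × Bool,
      ({ρ c ⟨0, by omega⟩, ρ c ⟨1, by omega⟩} : Set (Fin m)) = {x, y} := by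
  have exists_of_lt (x : Fin m) (hx : (x : ℕ) < a) :
      ∃ i, x = σ i ⟨0, by omega⟩ ∨ x = σ i ⟨1, by omega⟩ := by
    obtain ⟨y, hxy, hy⟩ : ∃ y : Fin m, x ≠ y ∧ (y : ℕ) < a := by
      by_cases h : (x : ℕ) = 0
      · exact ⟨⟨1, by omega⟩, by simp [Fin.ext_iff, h], by simp; omega⟩
      · exact ⟨⟨0, by omega⟩, by simp [Fin.ext_iff, h], by simp; omega⟩
    obtain ⟨i, hi⟩ := hσ x y hxy hx hy
    have hmem : x ∈ ({x, y} : Set (Fin m)) := by simp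
    rw [← hi] at hmem
    exact ⟨i, by simpa using hmem⟩
  have exists_of_ge (x : Fin m) (hx : a ≤ (x : ℕ)) :
      ∃ j, x = τ j ⟨a, by omega⟩ ∨ x = τ j ⟨a + 1, by omega⟩ := by
    obtain ⟨y, hxy, hy⟩ : ∃ y : Fin m, x ≠ y ∧ a ≤ (y : ℕ) := by
      by_cases h : (x : ℕ) = a
      · exact ⟨⟨a + 1, by omega⟩, by simp [Fin.ext_iff, h], by simp⟩
      · exact ⟨⟨a, by omega⟩, by simp [Fin.ext_iff, h], le_rfl⟩
    obtain ⟨j, hj⟩ := hτ x y hxy hx hy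
    have hmem : x ∈ ({x, y} : Set (Fin m)) := by simp
    rw [← hj] at hmem
    exact ⟨j, by simpa using hmem⟩
  have mul_lt (i : I) (j : J) (p : Fin m) (hp : (p : ℕ) < a) : (σ i * τ j) p = σ i p := by
    rw [Equiv.Perm.mul_apply, hτfix j p hp]
  have mul_ge (i : I) (j : J) (p : Fin m) (hp : a ≤ (p : ℕ)) : (σ i * τ j) p = τ j p := by
    rw [Equiv.Perm.mul_apply]
    refine hσfix i _ (le_of_not_gt fun h => ?_)
    have := (τ j).injective (hτfix j _ h)
    omega
  set p : Fin m := ⟨0, by omega⟩ with hp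
  set q : Fin m := ⟨1, by omega⟩ with hq
  set r : Fin m := ⟨a, by omega⟩ with hr
  set s : Fin m := ⟨a + 1, by omega⟩ with hs
  have realize (i : I) (j : J) (x y : Fin m) (hxy : x ≠ y)
      (hx : x = σ i p ∨ x = σ i q ∨ x = τ j r ∨ x = τ j s)
      (hy : y = σ i p ∨ y = σ i q ∨ y = τ j r ∨ y = τ j s) :
      ∃ c, ({ρ c p, ρ c q} : Set (Fin m)) = {x, y} := by
    rw [← mul_lt i j p (by simp [hp]; omega), ← mul_lt i j q (by simp [hq]; omega),
      ← mul_ge i j r le_rfl, ← mul_ge i j s (by simp [hs])] at hx hy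
    simp only [← Equiv.symm_apply_eq] at hx hy
    obtain ⟨b₁, b₂, b₃, h⟩ := exists_swaps_pair_eq (p := p) (q := q) (r := r) (s := s)
      (by simp [hp, hq]) (by simp [hp, hr]; omega) (by simp [hp, hs])
      (by simp [hq, hr]; omega) (by simp [hq, hs]; omega) (by simp [hr, hs])
      (σ i * τ j) ((σ i * τ j).symm.injective.ne hxy) hx hy
    refine ⟨(i, j, b₁, b₂, b₃), ?_⟩
    rw [hρ, h, Equiv.apply_symm_apply, Equiv.apply_symm_apply]
  intro x y hxy
  rcases lt_or_ge (x : ℕ) a with hx | hx <;> rcases lt_or_ge (y : ℕ) a with hy | hy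
  · obtain ⟨i, hi⟩ := hσ x y hxy hx hy
    obtain ⟨j, -⟩ := exists_of_ge r le_rfl
    rw [Set.pair_eq_pair_iff] at hi
    exact realize i j x y hxy (by tauto) (by tauto)
  · obtain ⟨i, hi⟩ := exists_of_lt x hx
    obtain ⟨j, hj⟩ := exists_of_ge y hy
    exact realize i j x y hxy (by tauto) (by tauto)
  · obtain ⟨i, hi⟩ := exists_of_lt y hy
    obtain ⟨j, hj⟩ := exists_of_ge x hx
    exact realize i j x y hxy (by tauto) (by tauto)
  · obtain ⟨j, hj⟩ := hτ x y hxy hx hy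
    obtain ⟨i, -⟩ := exists_of_lt p (by simp [hp]; omega)
    rw [Set.pair_eq_pair_iff] at hj
    exact realize i j x y hxy (by tauto) (by tauto)
end

section
/- Let (Ω, μ) be a probability space, K ≥ 1, ε > 0, and let p : Fin K → ℝ with p i ≥ 0 for all i and ∑_i p i = 1. Let N be a positive integer with N ≥ K²/ε², and let q : Fin K → Ω → ℝ be integrable estimators such that for each i, ∫ q i dμ = p i and ∫ (q i ω − p i)² dμ(ω) = p i (1 − p i)/N. Then ∫ √(∑_i (K * q i ω − K * p i)²) dμ(ω) ≤ ε. (Theorem 2.2: at most O(2^{2 d_m}/ε²) calls to the state-preparation oracle 𝒪_m suffice to estimate all pairwise overlaps with expected ℓ²-error at most ε, where K = 2^{d_m}.) -/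
open scoped BigOperators
open MeasureTheory

/-- Theorem 2.2: with `N ≥ K²/ε²` samples (oracle calls), the unbiased
multinomial estimators of the `K = 2^{d_m}` outcome probabilities give an
estimate of all rescaled overlaps `δ = K·p − 1` with expected `ℓ²`-error at
most `ε`. -/
theorem sample_complexity {Ω : Type*} [MeasurableSpace Ω]
    (μ : Measure Ω) [IsProbabilityMeasure μ]
    (K : ℕ) (hK : 1 ≤ K) (ε : ℝ) (hε : 0 < ε)
    (p : Fin K → ℝ) (hp : ∀ i, 0 ≤ p i) (hsum : ∑ i, p i = 1)
    (N : ℕ) (hN : 1 ≤ N) (hNbig : (K : ℝ) ^ 2 / ε ^ 2 ≤ (N : ℝ))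
    (q : Fin K → Ω → ℝ)
    (hint : ∀ i, Integrable (q i) μ)
    (hint2 : ∀ i, Integrable (fun ω => (q i ω - p i) ^ 2) μ)
    (hmean : ∀ i, ∫ ω, q i ω ∂μ = p i)
    (hvar : ∀ i, ∫ ω, (q i ω - p i) ^ 2 ∂μ = p i * (1 - p i) / N) :
    ∫ ω, Real.sqrt (∑ i, ((K : ℝ) * q i ω - (K : ℝ) * p i) ^ 2) ∂μ ≤ ε := by
  have hN0 : (0 : ℝ) < N := by exact_mod_cast hN
  have hS (ω : Ω) : ∑ i, ((K : ℝ) * q i ω - (K : ℝ) * p i) ^ 2 =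
      (K : ℝ) ^ 2 * ∑ i, (q i ω - p i) ^ 2 := by
    rw [Finset.mul_sum]
    exact Finset.sum_congr rfl fun i _ => by ring
  simp only [hS]
  have hI : Integrable (fun ω => (K : ℝ) ^ 2 * ∑ i, (q i ω - p i) ^ 2) μ :=
    (integrable_finsetSum _ fun i _ => hint2 i).const_mul _
  have hp' : ∑ i, p i * (1 - p i) ≤ 1 := by
    refine (Finset.sum_le_sum fun i _ => ?_).trans hsum.le
    nlinarith [sq_nonneg (p i)]
  have hE : ∫ ω, (K : ℝ) ^ 2 * ∑ i, (q i ω - p i) ^ 2 ∂μ ≤ ε ^ 2 := by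
    rw [integral_const_mul, integral_finsetSum _ fun i _ => hint2 i]
    simp only [hvar]
    rw [← Finset.sum_div, ← mul_div_assoc, div_le_iff₀ hN0]
    rw [div_le_iff₀ (by positivity)] at hNbig
    nlinarith [mul_le_mul_of_nonneg_left hp' (sq_nonneg (K : ℝ))]
  -- Bound the square root pointwise by the AM-GM inequality `√x ≤ (x / ε + ε) / 2`.
  calc _ ≤ ∫ ω, (1 / (2 * ε) * ((K : ℝ) ^ 2 * ∑ i, (q i ω - p i) ^ 2) + ε / 2) ∂μ := by
        refine integral_mono_of_nonneg (.of_forall fun _ => Real.sqrt_nonneg _)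
          ((hI.const_mul _).add (integrable_const _)) (.of_forall fun ω => ?_)
        have h0 : 0 ≤ (K : ℝ) ^ 2 * ∑ i, (q i ω - p i) ^ 2 := by positivity
        beta_reduce
        generalize (K : ℝ) ^ 2 * ∑ i, (q i ω - p i) ^ 2 = x at h0 ⊢
        have hx := Real.sq_sqrt h0
        have key : 1 / (2 * ε) * x + ε / 2 = (x + ε ^ 2) / (2 * ε) := by
          field_simp
        rw [key, le_div_iff₀ (by positivity)]
        nlinarith [sq_nonneg (√x - ε)]
    _ = 1 / (2 * ε) * ∫ ω, (K : ℝ) ^ 2 * ∑ i, (q i ω - p i) ^ 2 ∂μ + ε / 2 := by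
        rw [integral_add (hI.const_mul _) (integrable_const _), integral_const_mul]
        simp
    _ ≤ 1 / (2 * ε) * ε ^ 2 + ε / 2 := by gcongr
    _ = ε := by field_simp; ring
end
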